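/- Lifting linear bounds to quadratic bounds: let α ∈ [0,1], let k ≥ 1 be an integer, and let c ≥ 0 be such that E^N_N(α) ≥ c · max{N − k, 0} for all integers N ≥ 1. Then for every integer N ≥ 1, writing s := 1 + √(2k/N), one has E^N_N(α) ≥ c · (N²/(4k)) · (2 s² − s⁴). -/

import Mathlib

noncomputable section

open MeasureTheory Real Set
open scoped BigOperators Topology

/-- The plane `ℝ²`, with points written as pairs. -/
abbrev Plane : Type := ℝ × ℝ

/-- Configuration space of `N` particles in the plane. -/
abbrev Config (N : ℕ) : Type := Fin N → Plane

/-- `x^{-⊥} := (-y, x)/(x² + y²)` for `x = (x, y) ∈ ℝ²`. -/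
def perpInv (v : Plane) : Plane :=
  (-v.2 / (v.1 ^ 2 + v.2 ^ 2), v.1 / (v.1 ^ 2 + v.2 ^ 2))

/-- The Aharonov–Bohm potential `A_j(x) = ∑_{k ≠ j} (x_j - x_k)^{-⊥}`. -/
def abPot (N : ℕ) (j : Fin N) (x : Config N) : Plane :=
  ∑ k ∈ Finset.univ.erase j, perpInv (x j - x k)

/-- Partial derivative of `Ψ` at `x` in direction `v` of the `j`-th particle. -/
def pder (N : ℕ) (j : Fin N) (v : Plane) (Ψ : Config N → ℂ) (x : Config N) : ℂ :=
  fderiv ℝ Ψ x (Pi.single j v)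

/-- The two components of `D_j Ψ = -i ∇_{x_j} Ψ + α A_j Ψ` at `x`. -/
def DOp (N : ℕ) (α : ℝ) (j : Fin N) (Ψ : Config N → ℂ) (x : Config N) : ℂ × ℂ :=
  (-Complex.I * pder N j (1, 0) Ψ x + Complex.ofReal (α * (abPot N j x).1) * Ψ x,
   -Complex.I * pder N j (0, 1) Ψ x + Complex.ofReal (α * (abPot N j x).2) * Ψ x)

/-- `|D_j Ψ(x)|²`, the squared Euclidean norm of the vector `D_j Ψ(x) ∈ ℂ²`. -/
def DSq (N : ℕ) (α : ℝ) (j : Fin N) (Ψ : Config N → ℂ) (x : Config N) : ℝ :=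
  ‖(DOp N α j Ψ x).1‖ ^ 2 + ‖(DOp N α j Ψ x).2‖ ^ 2

/-- The diagonal set `{x : x_j = x_k for some j ≠ k}`. -/
def diagSet (N : ℕ) : Set (Config N) := {x | ∃ j k : Fin N, j ≠ k ∧ x j = x k}

/-- Admissible wave functions: smooth, symmetric, vanishing on a neighbourhood of
the diagonal set. -/
structure Admissible (N : ℕ) (Ψ : Config N → ℂ) : Prop where
  smooth : ContDiff ℝ (⊤ : ℕ∞) Ψ
  symm : ∀ (σ : Equiv.Perm (Fin N)) (x : Config N), Ψ (x ∘ σ) = Ψ x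
  vanishes : ∃ U : Set (Config N), IsOpen U ∧ diagSet N ⊆ U ∧ ∀ x ∈ U, Ψ x = 0

/-- `Ω^N` as a subset of configuration space. -/
def cube (N : ℕ) (Ω : Set Plane) : Set (Config N) := Set.univ.pi fun _ => Ω

/-- Total kinetic energy `∑_j ∫_{Ω^N} |D_j Ψ|²`. -/
def kinE (N : ℕ) (α : ℝ) (Ω : Set Plane) (Ψ : Config N → ℂ) : ℝ :=
  ∑ j, ∫ x in cube N Ω, DSq N α j Ψ x

/-- `∫_{Ω^N} |Ψ|²`. -/
def normSq (N : ℕ) (Ω : Set Plane) (Ψ : Config N → ℂ) : ℝ :=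
  ∫ x in cube N Ω, ‖Ψ x‖ ^ 2

/-- Neumann ground-state energy of `N` anyons with statistics parameter `α` on `Ω`,
with the convention that it is `0` for `N = 0`. -/
def neumannE (N : ℕ) (α : ℝ) (Ω : Set Plane) : ℝ :=
  if N = 0 then 0 else
    sInf {E | ∃ Ψ : Config N → ℂ, Admissible N Ψ ∧ normSq N Ω Ψ = 1 ∧ E = kinE N α Ω Ψ}

/-- Dirichlet ground-state energy of `N` anyons with statistics parameter `α` on `Ω`. -/
def dirichletE (N : ℕ) (α : ℝ) (Ω : Set Plane) : ℝ :=
  sInf {E | ∃ Ψ : Config N → ℂ, Admissible N Ψ ∧ IsCompact (tsupport Ψ) ∧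
    tsupport Ψ ⊆ cube N Ω ∧ normSq N Ω Ψ = 1 ∧ E = kinE N α Ω Ψ}

/-- The open unit square `Q₀ = (0,1)²`. -/
def Q0 : Set Plane := Set.Ioo (0 : ℝ) 1 ×ˢ Set.Ioo (0 : ℝ) 1

/-- `E^N_N(α)`, the Neumann energy on the unit square. -/
def EN (N : ℕ) (α : ℝ) : ℝ := neumannE N α Q0

/-- `E^D_N(α)`, the Dirichlet energy on the unit square. -/
def ED (N : ℕ) (α : ℝ) : ℝ := dirichletE N α Q0

/-- One-particle density `ρ_Ψ` of a wave function of `n+1` particles. -/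
def density (n : ℕ) (Ψ : Config (n + 1) → ℂ) (y : Plane) : ℝ :=
  (n + 1) * ∫ z : Config n, ‖Ψ (Fin.cons y z)‖ ^ 2


/-! ### Elementary facts about the potential and the kinetic energy -/

lemma ql_perpInv_zero : perpInv (0 : Plane) = 0 := by
  simp [perpInv]

lemma ql_perpInv_smul (t : ℝ) (ht : t ≠ 0) (v : Plane) :
    perpInv (t • v) = t⁻¹ • perpInv v := by
  have key : ∀ a b : ℝ, (t * b) / ((t * v.1) ^ 2 + (t * v.2) ^ 2) =
      t⁻¹ * (b / (v.1 ^ 2 + v.2 ^ 2)) := by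
    intro a b
    have e : (t * v.1) ^ 2 + (t * v.2) ^ 2 = t * (t * (v.1 ^ 2 + v.2 ^ 2)) := by ring
    rw [e, mul_div_mul_left _ _ ht, div_mul_eq_div_div, div_right_comm, div_eq_inv_mul _ t]
  ext
  · simp only [perpInv, Prod.smul_fst, Prod.smul_snd, smul_eq_mul]
    have := key 0 (-v.2)
    rw [← this]; congr 1; ring
  · simp only [perpInv, Prod.smul_fst, Prod.smul_snd, smul_eq_mul]
    exact key 0 v.1

lemma ql_abPot_eq (N : ℕ) (j : Fin N) (x : Config N) :
    abPot N j x = ∑ k, perpInv (x j - x k) := by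
  unfold abPot
  rw [Finset.sum_erase]
  simp [ql_perpInv_zero]

lemma ql_DSq_nonneg (N : ℕ) (α : ℝ) (j : Fin N) (Ψ : Config N → ℂ) (x : Config N) :
    0 ≤ DSq N α j Ψ x := by
  unfold DSq; positivity

lemma ql_kinE_nonneg (N : ℕ) (α : ℝ) (Ω : Set Plane) (Ψ : Config N → ℂ) :
    0 ≤ kinE N α Ω Ψ :=
  Finset.sum_nonneg fun j _ => integral_nonneg fun x => ql_DSq_nonneg N α j Ψ x

lemma ql_cont_perpInv {v : Plane} (hv : v ≠ 0) : ContinuousAt perpInv v := by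
  have h0 : v.1 ^ 2 + v.2 ^ 2 ≠ 0 := by
    intro h
    apply hv
    have h1 : v.1 = 0 := by nlinarith [sq_nonneg v.1, sq_nonneg v.2]
    have h2 : v.2 = 0 := by nlinarith [sq_nonneg v.1, sq_nonneg v.2]
    exact Prod.ext h1 h2
  unfold perpInv
  apply ContinuousAt.prodMk
  · exact ContinuousAt.div (by fun_prop) (by fun_prop) h0
  · exact ContinuousAt.div (by fun_prop) (by fun_prop) h0

lemma ql_cont_DSq {N : ℕ} {Ψ : Config N → ℂ} (hΨ : Admissible N Ψ) (α : ℝ) (j : Fin N) :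
    Continuous (DSq N α j Ψ) := by
  obtain ⟨U, hU, hdU, hzero⟩ := hΨ.vanishes
  have hp : ∀ v : Plane, Continuous (fun x => pder N j v Ψ x) := by
    intro v
    have := hΨ.smooth.continuous_fderiv (by simp)
    unfold pder
    fun_prop
  have hA : ∀ L : Plane → ℝ, Continuous L →
      Continuous (fun x => Complex.ofReal (α * L (abPot N j x)) * Ψ x) := by
    intro L hL
    rw [continuous_iff_continuousAt]
    intro x
    by_cases hx : x ∈ diagSet N
    · have hxU : U ∈ 𝓝 x := hU.mem_nhds (hdU hx)
      have : (fun x => Complex.ofReal (α * L (abPot N j x)) * Ψ x) =ᶠ[𝓝 x] fun _ => 0 := by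
        filter_upwards [hxU] with y hy
        simp [hzero y hy]
      exact continuousAt_const.congr this.symm
    · have hc : ContinuousAt (fun x => abPot N j x) x := by
        unfold abPot
        apply tendsto_finsetSum
        intro k hk
        have hne : x j - x k ≠ 0 := by
          intro h0
          exact hx ⟨j, k, (Finset.ne_of_mem_erase hk).symm, sub_eq_zero.1 h0⟩
        have h1 : ContinuousAt (fun x : Config N => x j - x k) x := by fun_prop
        exact ContinuousAt.comp (f := fun x : Config N => x j - x k) (ql_cont_perpInv hne) h1
      have h2 : ContinuousAt (fun x => L (abPot N j x)) x :=
        ContinuousAt.comp (f := fun x => abPot N j x) hL.continuousAt hc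
      have h3 : ContinuousAt Ψ x := hΨ.smooth.continuous.continuousAt
      have h4 : ContinuousAt (fun x => Complex.ofReal (α * L (abPot N j x))) x :=
        ContinuousAt.comp (f := fun x => α * L (abPot N j x))
          Complex.continuous_ofReal.continuousAt (continuousAt_const.mul h2)
      exact h4.mul h3
  have h1 := hA Prod.fst continuous_fst
  have h2 := hA Prod.snd continuous_snd
  have h3 := hp (1, 0)
  have h4 := hp (0, 1)
  unfold DSq DOp
  fun_prop

lemma ql_DSq_smul {N : ℕ} {Ψ : Config N → ℂ} (hΨ : Admissible N Ψ) (α : ℝ) (j : Fin N)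
    (r : ℝ) (x : Config N) :
    DSq N α j (fun y => (r : ℂ) * Ψ y) x = r ^ 2 * DSq N α j Ψ x := by
  have hd : DifferentiableAt ℝ Ψ x := (hΨ.smooth.differentiable (by simp)).differentiableAt
  have hp : ∀ v, pder N j v (fun y => (r : ℂ) * Ψ y) x = (r : ℂ) * pder N j v Ψ x := by
    intro v
    unfold pder
    rw [fderiv_const_mul hd]
    simp
  have e : ∀ (a b d : ℂ), ‖-Complex.I * ((r : ℂ) * a) + b * ((r : ℂ) * d)‖ ^ 2 =
      r ^ 2 * ‖-Complex.I * a + b * d‖ ^ 2 := by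
    intro a b d
    rw [show -Complex.I * ((r : ℂ) * a) + b * ((r : ℂ) * d) =
      (r : ℂ) * (-Complex.I * a + b * d) by ring, norm_mul, mul_pow, Complex.norm_real,
      Real.norm_eq_abs, sq_abs]
  unfold DSq DOp
  simp only [hp, e]
  ring

lemma ql_EN_le {n : ℕ} (hn : 1 ≤ n) {Φ : Config n → ℂ} (hΦ : Admissible n Φ) (α : ℝ) :
    EN n α * normSq n Q0 Φ ≤ kinE n α Q0 Φ := by
  have hnn : 0 ≤ normSq n Q0 Φ := integral_nonneg fun x => by positivity
  rcases hnn.eq_or_lt with h0 | hpos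
  · rw [← h0, mul_zero]; exact ql_kinE_nonneg _ _ _ _
  set r : ℝ := (Real.sqrt (normSq n Q0 Φ))⁻¹ with hr
  have hr2 : r ^ 2 = (normSq n Q0 Φ)⁻¹ := by
    rw [hr, inv_pow, Real.sq_sqrt hnn]
  have hadm : Admissible n (fun y => (r : ℂ) * Φ y) := by
    obtain ⟨U, hU, hdU, hzero⟩ := hΦ.vanishes
    refine ⟨contDiff_const.mul hΦ.smooth, fun σ x => ?_, U, hU, hdU, fun x hx => ?_⟩
    · simp only [hΦ.symm]
    · simp [hzero x hx]
  have hnorm : normSq n Q0 (fun y => (r : ℂ) * Φ y) = 1 := by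
    unfold normSq
    simp only [norm_mul, mul_pow, Complex.norm_real, Real.norm_eq_abs, sq_abs]
    rw [integral_const_mul, hr2]
    exact inv_mul_cancel₀ hpos.ne'
  have hkin : kinE n α Q0 (fun y => (r : ℂ) * Φ y) = r ^ 2 * kinE n α Q0 Φ := by
    unfold kinE
    simp only [ql_DSq_smul hΦ, integral_const_mul, Finset.mul_sum]
  have hle : EN n α ≤ r ^ 2 * kinE n α Q0 Φ := by
    unfold EN neumannE
    rw [if_neg (by omega)]
    apply csInf_le
    · refine ⟨0, ?_⟩
      rintro E ⟨Ψ, -, -, rfl⟩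
      exact ql_kinE_nonneg _ _ _ _
    · exact ⟨_, hadm, hnorm, hkin.symm⟩
  rw [hr2] at hle
  calc EN n α * normSq n Q0 Φ ≤ ((normSq n Q0 Φ)⁻¹ * kinE n α Q0 Φ) * normSq n Q0 Φ := by gcongr
    _ = kinE n α Q0 Φ := by field_simp

/-! ### A globally smooth gauge function -/

lemma ql_exists_g (ε : ℝ) (hε : 0 < ε) : ∃ g : ℝ → ℝ, ContDiff ℝ (⊤ : ℕ∞) g ∧
    (∀ t, 0 < g t) ∧ ∀ t, ε ≤ t → g t = t := by
  have hs : ContDiff ℝ (⊤ : ℕ∞) (fun t : ℝ => Real.smoothTransition (2 * t / ε - 1)) := by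
    apply Real.smoothTransition.contDiff.comp
    fun_prop
  refine ⟨fun t => t * Real.smoothTransition (2 * t / ε - 1) +
    ε * (1 - Real.smoothTransition (2 * t / ε - 1)), ?_, ?_, ?_⟩
  · fun_prop
  · intro t
    have h0 := Real.smoothTransition.nonneg (2 * t / ε - 1)
    have h1 := Real.smoothTransition.le_one (2 * t / ε - 1)
    rcases le_or_gt t (ε / 2) with h | h
    · have : Real.smoothTransition (2 * t / ε - 1) = 0 := by
        apply Real.smoothTransition.zero_of_nonpos
        rw [sub_nonpos, div_le_one hε]; linarith
      simp only [this]; linarith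
    · simp only
      nlinarith
  · intro t ht
    have : Real.smoothTransition (2 * t / ε - 1) = 1 := by
      apply Real.smoothTransition.one_of_one_le
      rw [le_sub_iff_add_le, le_div_iff₀ hε]; linarith
    simp only [this]; ring

/-- Basic gauge function for points to the right of `0`. -/
lemma ql_gauge_right (ε : ℝ) (hε : 0 < ε) : ∃ θ : Plane → ℝ, ContDiff ℝ (⊤ : ℕ∞) θ ∧
    ∀ y : Plane, ε < y.1 → ∃ L : Plane →L[ℝ] ℝ, HasFDerivAt θ L y ∧
      ∀ v : Plane, L v = (perpInv y).1 * v.1 + (perpInv y).2 * v.2 := by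
  obtain ⟨g, hg, hpos, hgt⟩ := ql_exists_g ε hε
  refine ⟨fun y => Real.arctan (y.2 / g y.1), ?_, ?_⟩
  · apply Real.contDiff_arctan.comp
    apply contDiff_snd.div (hg.comp contDiff_fst)
    intro y; exact (hpos _).ne'
  · intro y hy
    have hy0 : 0 < y.1 := hε.trans hy
    have hev : (fun y : Plane => Real.arctan (y.2 / g y.1)) =ᶠ[𝓝 y]
        fun y : Plane => Real.arctan (y.2 * y.1⁻¹) := by
      have : ∀ᶠ w : Plane in 𝓝 y, ε < w.1 :=
        continuous_fst.continuousAt.eventually (lt_mem_nhds hy)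
      filter_upwards [this] with w hw
      rw [hgt _ hw.le, div_eq_mul_inv]
    have h1 : HasFDerivAt (fun y : Plane => y.1) (ContinuousLinearMap.fst ℝ ℝ ℝ) y :=
      hasFDerivAt_fst
    have h2 : HasFDerivAt (fun y : Plane => y.2) (ContinuousLinearMap.snd ℝ ℝ ℝ) y :=
      hasFDerivAt_snd
    have h3 := (hasDerivAt_inv hy0.ne').comp_hasFDerivAt y h1
    have h4 := (h2.mul h3).arctan
    refine ⟨_, h4.congr_of_eventuallyEq hev, ?_⟩
    intro v
    have hpos2 : y.1 ^ 2 + y.2 ^ 2 ≠ 0 := by positivity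
    simp [perpInv]
    field_simp

lemma ql_gauge (z : Plane) (hz : z.1 < 0 ∨ 1 < z.1 ∨ z.2 < 0 ∨ 1 < z.2) :
    ∃ θ : Plane → ℝ, ContDiff ℝ (⊤ : ℕ∞) θ ∧
    ∀ w ∈ Q0, ∃ L : Plane →L[ℝ] ℝ, HasFDerivAt θ L w ∧
      ∀ v : Plane, L v = (perpInv (w - z)).1 * v.1 + (perpInv (w - z)).2 * v.2 := by
  -- general reduction through an isometry commuting with `perpInv`
  have red : ∀ (R : Plane →L[ℝ] Plane) (ε : ℝ), 0 < ε → (∀ w ∈ Q0, ε < (R (w - z)).1) →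
      (∀ u v : Plane, (perpInv (R u)).1 * (R v).1 + (perpInv (R u)).2 * (R v).2 =
        (perpInv u).1 * v.1 + (perpInv u).2 * v.2) →
      ∃ θ : Plane → ℝ, ContDiff ℝ (⊤ : ℕ∞) θ ∧
    ∀ w ∈ Q0, ∃ L : Plane →L[ℝ] ℝ, HasFDerivAt θ L w ∧
      ∀ v : Plane, L v = (perpInv (w - z)).1 * v.1 + (perpInv (w - z)).2 * v.2 := by
    intro R ε hε hR hP
    obtain ⟨θ, hθ, hd⟩ := ql_gauge_right ε hε
    refine ⟨fun w => θ (R (w - z)), ?_, ?_⟩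
    · apply hθ.comp
      fun_prop
    · intro w hw
      obtain ⟨L, hL, hLv⟩ := hd _ (hR w hw)
      have hRd : HasFDerivAt (fun w => R (w - z)) R w := by
        have := R.hasFDerivAt.comp w ((hasFDerivAt_id w).sub_const z)
        exact this
      refine ⟨L.comp R, hL.comp w hRd, ?_⟩
      intro v
      rw [ContinuousLinearMap.comp_apply, hLv, hP]
  set F := ContinuousLinearMap.fst ℝ ℝ ℝ
  set S := ContinuousLinearMap.snd ℝ ℝ ℝ
  have hQ : ∀ w ∈ Q0, (0 < w.1 ∧ w.1 < 1) ∧ (0 < w.2 ∧ w.2 < 1) := by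
    intro w hw; exact hw
  rcases hz with h | h | h | h
  · refine red (F.prod S) (-z.1) (by linarith) (fun w hw => ?_) (fun u v => ?_)
    · have := hQ w hw; simp [F, S]; linarith
    · simp [F, S]
  · refine red ((-F).prod (-S)) (z.1 - 1) (by linarith) (fun w hw => ?_) (fun u v => ?_)
    · have := hQ w hw; simp [F, S]; linarith
    · simp [F, S, perpInv]; ring
  · refine red (S.prod (-F)) (-z.2) (by linarith) (fun w hw => ?_) (fun u v => ?_)
    · have := hQ w hw; simp [F, S]; linarith
    · simp [F, S, perpInv]; ring
  · refine red ((-S).prod F) (z.2 - 1) (by linarith) (fun w hw => ?_) (fun u v => ?_)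
    · have := hQ w hw; simp [F, S]; linarith
    · simp [F, S, perpInv]; ring

/-! ### Slicing: freezing the particles outside a given unit square -/

/-- Insert the (translated) particles `w` at the positions `p` and the particles `z` elsewhere. -/
def qlMerge {N n : ℕ} (p : Fin N → Prop) [DecidablePred p] (e : Fin n ≃ {i // p i}) (q : Plane)
    (w : Config n) (z : {i // ¬ p i} → Plane) : Config N :=
  fun i => if h : p i then w (e.symm ⟨i, h⟩) + q else z ⟨i, h⟩

section slice

variable {N n : ℕ} (p : Fin N → Prop) [DecidablePred p] (e : Fin n ≃ {i // p i}) (q : Plane)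

lemma qlMerge_pos (w : Config n) (z : {i // ¬ p i} → Plane) (i : Fin n) :
    qlMerge p e q w z (e i) = w i + q := by
  unfold qlMerge
  rw [dif_pos (e i).2]
  simp

lemma qlMerge_neg (w : Config n) (z : {i // ¬ p i} → Plane) (l : {i // ¬ p i}) :
    qlMerge p e q w z l = z l := by
  unfold qlMerge
  rw [dif_neg l.2]

lemma qlMerge_add (w : Config n) (z : {i // ¬ p i} → Plane) (i : Fin n) (v : Plane) (t : ℝ) :
    qlMerge p e q (w + t • (Pi.single i v : Config n)) z =
      qlMerge p e q w z + t • (Pi.single (e i : Fin N) v : Config N) := by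
  funext a
  by_cases h : p a
  · obtain ⟨b, hb⟩ := e.surjective ⟨a, h⟩
    have ha : a = (e b : Fin N) := by rw [hb]
    subst ha
    rw [Pi.add_apply, qlMerge_pos, qlMerge_pos, Pi.add_apply, Pi.smul_apply, Pi.smul_apply]
    have : (Pi.single (e i : Fin N) v : Config N) (e b : Fin N) =
        (Pi.single i v : Config n) b := by
      by_cases hbi : b = i
      · subst hbi; simp
      · have : (e b : Fin N) ≠ (e i : Fin N) := by
          intro h; exact hbi (e.injective (Subtype.ext h))
        rw [Pi.single_eq_of_ne this, Pi.single_eq_of_ne hbi]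
    rw [this]; abel
  · have hne : a ≠ (e i : Fin N) := by
      rintro rfl; exact h (e i).2
    have h1 := qlMerge_neg p e q (w + t • (Pi.single i v : Config n)) z ⟨a, h⟩
    have h2 := qlMerge_neg p e q w z ⟨a, h⟩
    simp only at h1 h2
    rw [h1, Pi.add_apply, h2, Pi.smul_apply, Pi.single_eq_of_ne hne]
    simp

lemma qlMerge_contDiff (z : {i // ¬ p i} → Plane) :
    ContDiff ℝ (⊤ : ℕ∞) (fun w => qlMerge p e q w z) := by
  rw [contDiff_pi]
  intro i
  unfold qlMerge
  by_cases h : p i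
  · simp only [h, dif_pos]
    fun_prop
  · simp only [h]
    exact contDiff_const

lemma qlMerge_perm (z : {i // ¬ p i} → Plane) (w : Config n) (σ : Equiv.Perm (Fin n)) :
    qlMerge p e q (w ∘ σ) z = qlMerge p e q w z ∘ (σ.extendDomain e) := by
  funext a
  by_cases h : p a
  · obtain ⟨b, hb⟩ := e.surjective ⟨a, h⟩
    have ha : a = (e b : Fin N) := by rw [hb]
    subst ha
    rw [Function.comp_apply, Equiv.Perm.extendDomain_apply_image, qlMerge_pos, qlMerge_pos]
    rfl
  · rw [Function.comp_apply, Equiv.Perm.extendDomain_apply_not_subtype _ _ h]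
    have h1 := qlMerge_neg p e q (w ∘ σ) z ⟨a, h⟩
    have h2 := qlMerge_neg p e q w z ⟨a, h⟩
    exact h1.trans h2.symm

lemma qlMerge_abPot (w : Config n) (z : {i // ¬ p i} → Plane) (i : Fin n) :
    abPot N (e i) (qlMerge p e q w z) =
      abPot n i w + ∑ l, perpInv (w i - (z l - q)) := by
  rw [ql_abPot_eq, ql_abPot_eq, ← Fintype.sum_subtype_add_sum_subtype p]
  congr 1
  · rw [← e.sum_comp]
    apply Finset.sum_congr rfl
    intro k _
    rw [qlMerge_pos, qlMerge_pos]
    congr 1; abel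
  · apply Finset.sum_congr rfl
    intro l _
    rw [qlMerge_pos, qlMerge_neg]
    congr 1; abel

lemma ql_slice {Ψ : Config N → ℂ} (hΨ : Admissible N Ψ) (α : ℝ) (hn : 1 ≤ n)
    (z : {i // ¬ p i} → Plane)
    (hz : ∀ l, (z l - q).1 < 0 ∨ 1 < (z l - q).1 ∨ (z l - q).2 < 0 ∨ 1 < (z l - q).2) :
    EN n α * ∫ w in cube n Q0, ‖Ψ (qlMerge p e q w z)‖ ^ 2 ≤
      ∑ i, ∫ w in cube n Q0, DSq N α (e i) Ψ (qlMerge p e q w z) := by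
  choose θ hθ hdθ using fun l => ql_gauge (z l - q) (hz l)
  set Θ : Config n → ℝ := fun w => ∑ i, ∑ l, θ l (w i) with hΘ
  have hΘs : ContDiff ℝ (⊤ : ℕ∞) Θ := by
    apply ContDiff.sum; intro i _
    apply ContDiff.sum; intro l _
    exact (hθ l).comp (contDiff_apply ℝ Plane i)
  set Φ : Config n → ℂ := fun w =>
    Complex.exp (Complex.I * ((α * Θ w : ℝ) : ℂ)) * Ψ (qlMerge p e q w z) with hΦ
  have hE : ∀ r : ℝ, ‖Complex.exp (Complex.I * (r : ℂ))‖ = 1 := by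
    intro r; rw [mul_comm]; exact Complex.norm_exp_ofReal_mul_I r
  have hms := qlMerge_contDiff p e q z
  have hadm : Admissible n Φ := by
    refine ⟨?_, ?_, ?_⟩
    · apply ContDiff.mul
      · apply ContDiff.cexp
        apply contDiff_const.mul
        exact Complex.ofRealCLM.contDiff.comp (contDiff_const.mul hΘs)
      · exact hΨ.smooth.comp hms
    · intro σ w
      have h1 : Θ (w ∘ σ) = Θ w := by
        simp only [hΘ, Function.comp_apply]
        exact Equiv.sum_comp σ (fun i => ∑ l, θ l (w i))
      simp only [hΦ, h1, qlMerge_perm, hΨ.symm]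
    · obtain ⟨U, hU, hdU, hzero⟩ := hΨ.vanishes
      refine ⟨(fun w => qlMerge p e q w z) ⁻¹' U, hU.preimage hms.continuous, ?_, ?_⟩
      · rintro w ⟨j, k, hjk, hw⟩
        apply hdU
        refine ⟨e j, e k, ?_, ?_⟩
        · intro h; exact hjk (e.injective (Subtype.ext h))
        · simp only [qlMerge_pos, hw]
      · intro w hw
        simp only [hΦ]
        rw [hzero _ hw, mul_zero]
  have hpder : ∀ w ∈ cube n Q0, ∀ i v, pder n i v Φ w =
      Complex.exp (Complex.I * ((α * Θ w : ℝ) : ℂ)) *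
        (Complex.I * ((α * ∑ l, ((perpInv (w i - (z l - q))).1 * v.1 +
          (perpInv (w i - (z l - q))).2 * v.2) : ℝ) : ℂ) * Ψ (qlMerge p e q w z) +
          pder N (e i) v Ψ (qlMerge p e q w z)) := by
    intro w hw i v
    have hΘd : HasDerivAt (fun t : ℝ => Θ (w + t • (Pi.single i v : Config n)))
        (∑ l, ((perpInv (w i - (z l - q))).1 * v.1 +
          (perpInv (w i - (z l - q))).2 * v.2)) 0 := by
      have hh : ∀ i' : Fin n, HasDerivAt
          (fun t : ℝ => ∑ l, θ l ((w + t • (Pi.single i v : Config n)) i'))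
          (if i' = i then (∑ l, ((perpInv (w i - (z l - q))).1 * v.1 +
          (perpInv (w i - (z l - q))).2 * v.2)) else 0) 0 := by
        intro i'
        split_ifs with hi
        · subst hi
          apply HasDerivAt.fun_sum
          intro l _
          obtain ⟨L, hL, hLv⟩ := hdθ l (w i') (hw i' (Set.mem_univ _))
          have := hL.hasLineDerivAt v
          rw [hLv] at this
          simpa [HasLineDerivAt] using this
        · simp only [Pi.add_apply, Pi.smul_apply, Pi.single_eq_of_ne hi, smul_zero, add_zero]
          exact hasDerivAt_const _ _
      have h2 := HasDerivAt.fun_sum (u := Finset.univ) (fun i' _ => hh i')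
      simpa [hΘ] using h2
    have hΨd : HasDerivAt (fun t : ℝ => Ψ (qlMerge p e q (w + t • (Pi.single i v : Config n)) z))
        (pder N (e i) v Ψ (qlMerge p e q w z)) 0 := by
      simp only [qlMerge_add]
      exact ((hΨ.smooth.differentiable (by simp)) _).hasFDerivAt.hasLineDerivAt _
    have hexp : HasDerivAt (fun t : ℝ =>
        Complex.exp (Complex.I * ((α * Θ (w + t • (Pi.single i v : Config n)) : ℝ) : ℂ))) _ 0 :=
      ((hΘd.const_mul α).ofReal_comp.const_mul Complex.I).cexp
    have hprod := hexp.mul hΨd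
    have hΦd : HasDerivAt (fun t : ℝ => Φ (w + t • (Pi.single i v : Config n))) (pder n i v Φ w) 0 :=
      ((hadm.smooth.differentiable (by simp)) _).hasFDerivAt.hasLineDerivAt _
    rw [hΦd.unique hprod]
    simp only [zero_smul, add_zero]
    ring
  have hD : ∀ w ∈ cube n Q0, ∀ i, DSq n α i Φ w = DSq N α (e i) Ψ (qlMerge p e q w z) := by
    intro w hw i
    have hfst : (abPot N (e i) (qlMerge p e q w z)).1 =
        (abPot n i w).1 + ∑ l, (perpInv (w i - (z l - q))).1 := by
      rw [qlMerge_abPot, Prod.fst_add, Prod.fst_sum]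
    have hsnd : (abPot N (e i) (qlMerge p e q w z)).2 =
        (abPot n i w).2 + ∑ l, (perpInv (w i - (z l - q))).2 := by
      rw [qlMerge_abPot, Prod.snd_add, Prod.snd_sum]
    have alg : ∀ (X P ψ : ℂ) (a b : ℝ), ‖X‖ = 1 →
        ‖-Complex.I * (X * (Complex.I * ((α * b : ℝ) : ℂ) * ψ + P)) +
          Complex.ofReal (α * a) * (X * ψ)‖ ^ 2 =
        ‖-Complex.I * P + Complex.ofReal (α * (a + b)) * ψ‖ ^ 2 := by
      intro X P ψ a b hX
      have : -Complex.I * (X * (Complex.I * ((α * b : ℝ) : ℂ) * ψ + P)) +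
          Complex.ofReal (α * a) * (X * ψ) =
          X * (-Complex.I * P + Complex.ofReal (α * (a + b)) * ψ) := by
        push_cast
        linear_combination (-X * α * b * ψ) * Complex.I_sq
      rw [this, norm_mul, hX, one_mul]
    unfold DSq DOp
    simp only [hpder w hw, hfst, hsnd, mul_one, mul_zero, add_zero, zero_add]
    simp only [hΦ]
    rw [alg _ _ _ _ _ (hE _), alg _ _ _ _ _ (hE _)]
  have hmeas : MeasurableSet (cube n Q0) :=
    MeasurableSet.univ_pi fun _ => (measurableSet_Ioo.prod measurableSet_Ioo)
  have hkin : kinE n α Q0 Φ = ∑ i, ∫ w in cube n Q0, DSq N α (e i) Ψ (qlMerge p e q w z) := by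
    unfold kinE
    apply Finset.sum_congr rfl
    intro i _
    exact setIntegral_congr_fun hmeas fun w hw => hD w hw i
  have hnorm : normSq n Q0 Φ = ∫ w in cube n Q0, ‖Ψ (qlMerge p e q w z)‖ ^ 2 := by
    unfold normSq
    simp only [hΦ, norm_mul, hE, one_mul]
  rw [← hkin, ← hnorm]
  exact ql_EN_le hn hadm α

end slice

/-! ### The estimate on a cell -/

section cell

variable {N n : ℕ} (p : Fin N → Prop) [DecidablePred p] (e : Fin n ≃ {i // p i}) (q : Plane)

/-- The measurable equivalence behind `qlMerge`. -/
def qlEquiv : (Config n × ({i // ¬ p i} → Plane)) ≃ᵐ Config N :=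
  (MeasurableEquiv.prodCongr
    ((MeasurableEquiv.addRight (fun _ => q : Config n)).trans
      (MeasurableEquiv.piCongrLeft (fun _ : {i // p i} => Plane) e))
    (MeasurableEquiv.refl _)).trans
  (MeasurableEquiv.piEquivPiSubtypeProd (fun _ : Fin N => Plane) p).symm

lemma qlEquiv_apply (u : Config n × ({i // ¬ p i} → Plane)) :
    qlEquiv p e q u = qlMerge p e q u.1 u.2 := by
  funext a
  have h0 : qlEquiv p e q u a = if h : p a then
      MeasurableEquiv.piCongrLeft (fun _ : {i // p i} => Plane) e (u.1 + fun _ => q) ⟨a, h⟩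
      else u.2 ⟨a, h⟩ := rfl
  rw [h0]
  unfold qlMerge
  split_ifs with h
  · obtain ⟨b, hb⟩ := e.surjective ⟨a, h⟩
    rw [← hb, MeasurableEquiv.piCongrLeft_apply_apply]
    simp
  · rfl

lemma qlEquiv_mp : MeasurePreserving (qlEquiv p e q)
    (volume.prod volume : Measure (Config n × ({i // ¬ p i} → Plane))) volume := by
  have h1 : MeasurePreserving (MeasurableEquiv.addRight (fun _ => q : Config n)) volume volume :=
    measurePreserving_add_right volume _
  have h2 := volume_measurePreserving_piCongrLeft (fun _ : {i // p i} => Plane) e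
  have h3 := (volume_preserving_piEquivPiSubtypeProd (fun _ : Fin N => Plane) p).symm
  have h4 := (h2.comp h1).prod (MeasurePreserving.id
    (volume : Measure ({i // ¬ p i} → Plane)))
  exact h3.comp h4

lemma ql_cell {Ψ : Config N → ℂ} (hΨ : Admissible N Ψ) (α : ℝ) (hn : 1 ≤ n)
    (S : Fin N → Set Plane) (hSm : ∀ i, MeasurableSet (S i))
    (hp : ∀ i, p i → S i = {x | x - q ∈ Q0})
    (hnp : ∀ i, ¬ p i → ∀ x ∈ S i,
      (x - q).1 < 0 ∨ 1 < (x - q).1 ∨ (x - q).2 < 0 ∨ 1 < (x - q).2)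
    (hint : ∀ F : Config N → ℝ, Continuous F → IntegrableOn F (Set.univ.pi S)) :
    EN n α * ∫ x in Set.univ.pi S, ‖Ψ x‖ ^ 2 ≤
      ∑ i, ∫ x in Set.univ.pi S, DSq N α (e i) Ψ x := by
  set T : Set ({i // ¬ p i} → Plane) := Set.univ.pi fun l => S l with hT
  have hTm : MeasurableSet T := MeasurableSet.univ_pi fun l => hSm l
  have hpre : qlEquiv p e q ⁻¹' (Set.univ.pi S) = cube n Q0 ×ˢ T := by
    ext ⟨w, z⟩
    simp only [Set.mem_preimage, qlEquiv_apply, Set.mem_prod, cube, hT, Set.mem_univ_pi]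
    constructor
    · intro H
      refine ⟨fun i => ?_, fun l => ?_⟩
      · have := H (e i)
        rw [hp _ (e i).2, qlMerge_pos] at this
        simpa using this
      · have := H l
        rwa [qlMerge_neg] at this
    · rintro ⟨H1, H2⟩ a
      by_cases h : p a
      · obtain ⟨b, hb⟩ := e.surjective ⟨a, h⟩
        have ha : a = (e b : Fin N) := by rw [hb]
        subst ha
        rw [hp _ h, qlMerge_pos]
        simpa using H1 b
      · have h1 := qlMerge_neg p e q w z ⟨a, h⟩
        simp only at h1
        rw [h1]
        exact H2 ⟨a, h⟩
  have hmp := qlEquiv_mp p e q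
  have hemb := (qlEquiv p e q).measurableEmbedding
  have hI : ∀ F : Config N → ℝ, Continuous F →
      Integrable (fun u : Config n × ({i // ¬ p i} → Plane) => F (qlMerge p e q u.1 u.2))
        ((volume.restrict (cube n Q0)).prod (volume.restrict T)) := by
    intro F hF
    have h1 := (hmp.integrableOn_comp_preimage hemb (f := F) (s := Set.univ.pi S)).2 (hint F hF)
    rw [hpre] at h1
    rw [Measure.prod_restrict]
    refine Integrable.congr h1 (Filter.Eventually.of_forall fun u => ?_)
    simp only [Function.comp_apply, qlEquiv_apply]
  have hF : ∀ F : Config N → ℝ, Continuous F → ∫ x in Set.univ.pi S, F x =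
      ∫ z in T, ∫ w in cube n Q0, F (qlMerge p e q w z) := by
    intro F hF
    rw [← hmp.setIntegral_preimage_emb hemb F, hpre, ← Measure.prod_restrict]
    simp only [qlEquiv_apply]
    exact integral_prod_symm _ (hI F hF)
  have hcΨ : Continuous fun x => ‖Ψ x‖ ^ 2 := by
    have := hΨ.smooth.continuous
    fun_prop
  rw [hF _ hcΨ]
  simp only [fun i : Fin n => hF _ (ql_cont_DSq hΨ α (e i : Fin N))]
  rw [← integral_const_mul, ← integral_finsetSum]
  · apply setIntegral_mono_on
    · exact ((hI _ hcΨ).integral_prod_right).const_mul _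
    · apply integrable_finsetSum
      intro i _
      exact (hI _ (ql_cont_DSq hΨ α (e i : Fin N))).integral_prod_right
    · exact hTm
    · intro z hz
      apply ql_slice p e q hΨ α hn z
      intro l
      exact hnp l l.2 _ (hz l (Set.mem_univ _))
  · intro i _
    exact (hI _ (ql_cont_DSq hΨ α (e i : Fin N))).integral_prod_right

end cell

/-! ### Decomposition of a large square into unit cells -/

/-- Open unit cell with lower left corner `a`. -/
def qlCell {m : ℕ} (a : Fin m × Fin m) : Set Plane :=
  Set.Ioo ((a.1 : ℕ) : ℝ) ((a.1 : ℕ) + 1) ×ˢ Set.Ioo ((a.2 : ℕ) : ℝ) ((a.2 : ℕ) + 1)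

/-- Half-open unit cell with lower left corner `a`. -/
def qlCellC {m : ℕ} (a : Fin m × Fin m) : Set Plane :=
  Set.Ico ((a.1 : ℕ) : ℝ) ((a.1 : ℕ) + 1) ×ˢ Set.Ico ((a.2 : ℕ) : ℝ) ((a.2 : ℕ) + 1)

/-- The open square of side length `m`. -/
def qlBox (m : ℕ) : Set Plane := Set.Ioo (0 : ℝ) m ×ˢ Set.Ioo (0 : ℝ) m

lemma ql_floor_mem {m : ℕ} {t : ℝ} (ht : t ∈ Set.Ico (0 : ℝ) m) :
    ∃ a : Fin m, t ∈ Set.Ico ((a : ℕ) : ℝ) ((a : ℕ) + 1) :=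
  ⟨⟨⌊t⌋₊, (Nat.floor_lt ht.1).2 ht.2⟩, Nat.floor_le ht.1, Nat.lt_floor_add_one t⟩

lemma ql_Ico_unique {a b : ℕ} {t : ℝ} (ha : t ∈ Set.Ico (a : ℝ) (a + 1))
    (hb : t ∈ Set.Ico (b : ℝ) (b + 1)) : a = b := by
  have h1 : (a : ℝ) < b + 1 := ha.1.trans_lt hb.2
  have h2 : (b : ℝ) < a + 1 := hb.1.trans_lt ha.2
  norm_cast at h1 h2
  omega

lemma ql_integrableOn {N : ℕ} (S : Fin N → Set Plane) (R : ℝ)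
    (hS : ∀ i, S i ⊆ Set.Icc (0 : ℝ) R ×ˢ Set.Icc (0 : ℝ) R)
    (F : Config N → ℝ) (hF : Continuous F) : IntegrableOn F (Set.univ.pi S) := by
  have hc : IsCompact (Set.univ.pi fun _ : Fin N => Set.Icc (0 : ℝ) R ×ˢ Set.Icc (0 : ℝ) R) :=
    isCompact_univ_pi fun _ => isCompact_Icc.prod isCompact_Icc
  exact (hF.continuousOn.integrableOn_compact hc).mono_set (Set.pi_mono fun i _ => hS i)

lemma ql_Icc_sub {m : ℕ} (a : Fin m) :
    Set.Icc ((a : ℕ) : ℝ) ((a : ℕ) + 1) ⊆ Set.Icc (0 : ℝ) m := by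
  apply Set.Icc_subset_Icc (by positivity)
  have := a.2
  exact_mod_cast this

lemma qlCell_sub {m : ℕ} (a : Fin m × Fin m) :
    qlCell a ⊆ Set.Icc (0 : ℝ) m ×ˢ Set.Icc (0 : ℝ) m :=
  Set.prod_mono (Set.Ioo_subset_Icc_self.trans (ql_Icc_sub _))
    (Set.Ioo_subset_Icc_self.trans (ql_Icc_sub _))

lemma qlCellC_sub {m : ℕ} (a : Fin m × Fin m) :
    qlCellC a ⊆ Set.Icc (0 : ℝ) m ×ˢ Set.Icc (0 : ℝ) m :=
  Set.prod_mono (Set.Ico_subset_Icc_self.trans (ql_Icc_sub _))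
    (Set.Ico_subset_Icc_self.trans (ql_Icc_sub _))

lemma ql_decomp {N m : ℕ} (F : Config N → ℝ) (hF : Continuous F) :
    ∫ x in cube N (qlBox m), F x =
      ∑ f : Fin N → Fin m × Fin m, ∫ x in Set.univ.pi (fun i => qlCell (f i)), F x := by
  have h1 : cube N (qlBox m) =ᵐ[volume]
      (Set.univ.pi fun _ : Fin N => Set.Ico (0 : ℝ) m ×ˢ Set.Ico (0 : ℝ) m : Set (Config N)) :=
    Measure.ae_eq_set_pi fun i _ => Measure.set_prod_ae_eq Ioo_ae_eq_Ico Ioo_ae_eq_Ico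
  have h2 : ∀ f : Fin N → Fin m × Fin m,
      (Set.univ.pi (fun i => qlCell (f i)) : Set (Config N)) =ᵐ[volume]
      (Set.univ.pi (fun i => qlCellC (f i)) : Set (Config N)) := fun f =>
    Measure.ae_eq_set_pi fun i _ => Measure.set_prod_ae_eq Ioo_ae_eq_Ico Ioo_ae_eq_Ico
  rw [setIntegral_congr_set h1]
  simp only [fun f => setIntegral_congr_set (f := F) (h2 f)]
  rw [← integral_iUnion_fintype]
  · congr 2
    ext x
    simp only [Set.mem_univ_pi, Set.mem_iUnion]
    constructor
    · intro H
      choose a ha using fun i => ql_floor_mem (H i).1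
      choose b hb using fun i => ql_floor_mem (H i).2
      exact ⟨fun i => (a i, b i), fun i => ⟨ha i, hb i⟩⟩
    · rintro ⟨f, hf⟩ i
      have hsub : ∀ a : Fin m,
          Set.Ico ((a : ℕ) : ℝ) ((a : ℕ) + 1) ⊆ Set.Ico (0 : ℝ) m := by
        intro a
        apply Set.Ico_subset_Ico (by positivity)
        have := a.2
        exact_mod_cast this
      exact ⟨hsub _ (hf i).1, hsub _ (hf i).2⟩
  · intro f
    exact MeasurableSet.univ_pi fun i => measurableSet_Ico.prod measurableSet_Ico
  · intro f g hfg
    rw [Function.onFun, Set.disjoint_left]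
    intro x hx hy
    apply hfg
    funext i
    have h3 := hx i (Set.mem_univ _)
    have h4 := hy i (Set.mem_univ _)
    exact Prod.ext (Fin.ext (ql_Ico_unique h3.1 h4.1)) (Fin.ext (ql_Ico_unique h3.2 h4.2))
  · intro f
    exact ql_integrableOn _ m (fun i => qlCellC_sub _) F hF

lemma qlCell_eq {m : ℕ} (a : Fin m × Fin m) :
    qlCell a = {x | x - (((a.1 : ℕ) : ℝ), ((a.2 : ℕ) : ℝ)) ∈ Q0} := by
  ext x
  simp only [qlCell, Q0, Set.mem_prod, Set.mem_Ioo, Set.mem_ofPred_eq, Prod.fst_sub, Prod.snd_sub]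
  constructor
  · rintro ⟨⟨_, _⟩, _, _⟩
    refine ⟨⟨?_, ?_⟩, ?_, ?_⟩ <;> linarith
  · rintro ⟨⟨_, _⟩, _, _⟩
    refine ⟨⟨?_, ?_⟩, ?_, ?_⟩ <;> linarith

lemma qlCell_sep {m : ℕ} (a b : Fin m × Fin m) (hab : b ≠ a) (x : Plane) (hx : x ∈ qlCell b) :
    let q : Plane := (((a.1 : ℕ) : ℝ), ((a.2 : ℕ) : ℝ))
    (x - q).1 < 0 ∨ 1 < (x - q).1 ∨ (x - q).2 < 0 ∨ 1 < (x - q).2 := by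
  intro q
  obtain ⟨⟨h1, h2⟩, h3, h4⟩ := hx
  simp only [q, Prod.fst_sub, Prod.snd_sub]
  by_cases e1 : b.1 = a.1
  · have e2 : b.2 ≠ a.2 := fun h => hab (Prod.ext e1 h)
    rcases lt_or_gt_of_ne e2 with h | h
    · right; right; left
      have h' : ((b.2 : ℕ) : ℝ) + 1 ≤ ((a.2 : ℕ) : ℝ) := by exact_mod_cast h
      linarith
    · right; right; right
      have h' : ((a.2 : ℕ) : ℝ) + 1 ≤ ((b.2 : ℕ) : ℝ) := by exact_mod_cast h
      linarith
  · rcases lt_or_gt_of_ne e1 with h | h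
    · left
      have h' : ((b.1 : ℕ) : ℝ) + 1 ≤ ((a.1 : ℕ) : ℝ) := by exact_mod_cast h
      linarith
    · right; left
      have h' : ((a.1 : ℕ) : ℝ) + 1 ≤ ((b.1 : ℕ) : ℝ) := by exact_mod_cast h
      linarith

lemma ql_box {α : ℝ} {k : ℕ} {c : ℝ} (hc : 0 ≤ c)
    (h : ∀ N : ℕ, 1 ≤ N → c * max ((N : ℝ) - (k : ℝ)) 0 ≤ EN N α)
    {N m : ℕ} {Ψ : Config N → ℂ} (hΨ : Admissible N Ψ) :
    c * ((N : ℝ) - k * (m : ℝ) ^ 2) * normSq N (qlBox m) Ψ ≤ kinE N α (qlBox m) Ψ := by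
  have hcΨ : Continuous fun x => ‖Ψ x‖ ^ 2 := by
    have := hΨ.smooth.continuous
    fun_prop
  unfold normSq kinE
  simp only [ql_decomp _ hcΨ, fun j => ql_decomp (m := m) _ (ql_cont_DSq hΨ α j)]
  rw [Finset.sum_comm, Finset.mul_sum]
  apply Finset.sum_le_sum
  intro f _
  set I : ℝ := ∫ x in Set.univ.pi (fun i => qlCell (f i)), ‖Ψ x‖ ^ 2 with hI
  have hI0 : 0 ≤ I := integral_nonneg fun x => by positivity
  set G : Fin N → ℝ := fun j => ∫ x in Set.univ.pi (fun i => qlCell (f i)), DSq N α j Ψ x with hG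
  have hG0 : ∀ j, 0 ≤ G j := fun j => integral_nonneg fun x => ql_DSq_nonneg N α j Ψ x
  have hQ : ∀ a : Fin m × Fin m,
      c * ((Fintype.card {j // f j = a} : ℝ) - k) * I ≤ ∑ j : {j // f j = a}, G j := by
    intro a
    have hr0 : 0 ≤ ∑ j : {j // f j = a}, G j := Finset.sum_nonneg fun j _ => hG0 j
    rcases Nat.eq_zero_or_pos (Fintype.card {j // f j = a}) with h0 | hpos
    · rw [h0]
      refine le_trans ?_ hr0
      have : 0 ≤ c * k * I := by positivity
      push_cast
      nlinarith
    · have e : Fin (Fintype.card {j // f j = a}) ≃ {j // f j = a} := (Fintype.equivFin _).symm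
      have h1 := ql_cell (fun j => f j = a) e (((a.1 : ℕ) : ℝ), ((a.2 : ℕ) : ℝ)) hΨ α hpos
        (fun i => qlCell (f i)) (fun i => measurableSet_Ioo.prod measurableSet_Ioo)
        (fun i hi => by rw [hi]; exact qlCell_eq a)
        (fun i hi x hx => qlCell_sep a (f i) hi x hx)
        (fun F hF => ql_integrableOn _ m (fun i => qlCell_sub _) F hF)
      rw [← e.sum_comp]
      refine le_trans ?_ h1
      apply mul_le_mul_of_nonneg_right _ hI0
      exact le_trans (mul_le_mul_of_nonneg_left (le_max_left _ _) hc) (h _ hpos)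
  have hsum : ∑ a : Fin m × Fin m, ∑ j : {j // f j = a}, G j = ∑ j, G j :=
    Fintype.sum_fiberwise f G
  have hcard : ∑ a : Fin m × Fin m, (Fintype.card {j // f j = a} : ℝ) = N := by
    have := Fintype.sum_fiberwise f (fun _ => (1 : ℝ))
    simpa using this
  rw [← hsum]
  refine le_trans (le_of_eq ?_) (Finset.sum_le_sum fun a _ => hQ a)
  rw [← Finset.sum_mul, ← Finset.mul_sum, Finset.sum_sub_distrib, hcard]
  simp
  ring_nf
  simp

/-! ### Scaling -/

open scoped Pointwise in
lemma ql_scale_cube (N m : ℕ) (hm : 1 ≤ m) : ((m : ℝ)⁻¹) • cube N (qlBox m) = cube N Q0 := by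
  have hm0 : (0 : ℝ) < m := by exact_mod_cast hm
  ext x
  rw [Set.mem_smul_set_iff_inv_smul_mem₀ (inv_ne_zero hm0.ne'), inv_inv]
  simp only [cube, Set.mem_univ_pi, qlBox, Q0, Set.mem_prod, Set.mem_Ioo, Pi.smul_apply,
    Prod.smul_fst, Prod.smul_snd, smul_eq_mul]
  apply forall_congr'
  intro i
  rw [mul_pos_iff_of_pos_left hm0, mul_pos_iff_of_pos_left hm0,
    mul_lt_iff_lt_one_right hm0, mul_lt_iff_lt_one_right hm0]

lemma ql_scale_adm {N : ℕ} {Ψ : Config N → ℂ} (hΨ : Admissible N Ψ) (r : ℝ) :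
    Admissible N (fun x => Ψ (r • x)) := by
  obtain ⟨U, hU, hdU, hzero⟩ := hΨ.vanishes
  refine ⟨hΨ.smooth.comp (contDiff_const_smul r), fun σ x => ?_,
    (fun x => r • x) ⁻¹' U, hU.preimage (continuous_const_smul r), ?_, fun x hx => hzero _ hx⟩
  · exact hΨ.symm σ (r • x)
  · rintro x ⟨j, k, hjk, hx⟩
    apply hdU
    exact ⟨j, k, hjk, by simp [hx]⟩

lemma ql_scale_DSq {N : ℕ} {Ψ : Config N → ℂ} (hΨ : Admissible N Ψ) (α r : ℝ) (hr : r ≠ 0)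
    (j : Fin N) (x : Config N) :
    DSq N α j (fun x => Ψ (r • x)) x = r ^ 2 * DSq N α j Ψ (r • x) := by
  have hp : ∀ v, pder N j v (fun x => Ψ (r • x)) x = (r : ℂ) * pder N j v Ψ (r • x) := by
    intro v
    unfold pder
    rw [fderiv_comp_smul]
    simp
  have hA : abPot N j x = r • abPot N j (r • x) := by
    unfold abPot
    rw [Finset.smul_sum]
    apply Finset.sum_congr rfl
    intro k _
    rw [Pi.smul_apply, Pi.smul_apply, ← smul_sub, ql_perpInv_smul r hr, smul_smul,
      mul_inv_cancel₀ hr, one_smul]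
  have e : ∀ (a d : ℂ) (b : ℝ), ‖-Complex.I * ((r : ℂ) * a) + Complex.ofReal (α * (r * b)) * d‖ ^ 2
      = r ^ 2 * ‖-Complex.I * a + Complex.ofReal (α * b) * d‖ ^ 2 := by
    intro a d b
    rw [show -Complex.I * ((r : ℂ) * a) + Complex.ofReal (α * (r * b)) * d =
      (r : ℂ) * (-Complex.I * a + Complex.ofReal (α * b) * d) by push_cast; ring,
      norm_mul, mul_pow, Complex.norm_real, Real.norm_eq_abs, sq_abs]
  unfold DSq DOp
  rw [hA]
  simp only [hp, Prod.smul_fst, Prod.smul_snd, smul_eq_mul, e]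
  ring

lemma ql_square {α : ℝ} {k : ℕ} {c : ℝ} (hc : 0 ≤ c)
    (h : ∀ N : ℕ, 1 ≤ N → c * max ((N : ℝ) - (k : ℝ)) 0 ≤ EN N α)
    {N m : ℕ} (hm : 1 ≤ m) {Ψ : Config N → ℂ} (hΨ : Admissible N Ψ) :
    c * (m : ℝ) ^ 2 * ((N : ℝ) - k * (m : ℝ) ^ 2) * normSq N Q0 Ψ ≤ kinE N α Q0 Ψ := by
  have hm0 : (0 : ℝ) < m := by exact_mod_cast hm
  have hr : ((m : ℝ)⁻¹) ≠ 0 := inv_ne_zero hm0.ne'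
  have hb := ql_box hc h (m := m) (ql_scale_adm hΨ ((m : ℝ)⁻¹))
  set κ : ℝ := |(((m : ℝ)⁻¹) ^ Module.finrank ℝ (Config N))⁻¹| with hκ
  have hκ0 : 0 < κ := by positivity
  have hF : ∀ F : Config N → ℝ, ∫ x in cube N (qlBox m), F ((m : ℝ)⁻¹ • x) =
      κ * ∫ x in cube N Q0, F x := by
    intro F
    rw [Measure.setIntegral_comp_smul _ _ _ hr, ql_scale_cube N m hm, smul_eq_mul]
  have h1 : normSq N (qlBox m) (fun x => Ψ ((m : ℝ)⁻¹ • x)) = κ * normSq N Q0 Ψ := by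
    unfold normSq
    exact hF (fun x => ‖Ψ x‖ ^ 2)
  have h2 : kinE N α (qlBox m) (fun x => Ψ ((m : ℝ)⁻¹ • x)) =
      ((m : ℝ)⁻¹) ^ 2 * (κ * kinE N α Q0 Ψ) := by
    unfold kinE
    simp only [ql_scale_DSq hΨ α _ hr, integral_const_mul, Finset.mul_sum, hF]
  rw [h1, h2] at hb
  have h3 : κ * (c * (m : ℝ) ^ 2 * ((N : ℝ) - k * (m : ℝ) ^ 2) * normSq N Q0 Ψ) ≤
      κ * kinE N α Q0 Ψ := by
    calc κ * (c * (m : ℝ) ^ 2 * ((N : ℝ) - k * (m : ℝ) ^ 2) * normSq N Q0 Ψ)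
        = (m : ℝ) ^ 2 * (c * ((N : ℝ) - k * (m : ℝ) ^ 2) * (κ * normSq N Q0 Ψ)) := by ring
      _ ≤ (m : ℝ) ^ 2 * (((m : ℝ)⁻¹) ^ 2 * (κ * kinE N α Q0 Ψ)) := by gcongr
      _ = κ * kinE N α Q0 Ψ := by field_simp
  exact le_of_mul_le_mul_left h3 hκ0

lemma ql_EN_ge {α : ℝ} {k : ℕ} (hk : 1 ≤ k) {c : ℝ} (hc : 0 ≤ c)
    (h : ∀ N : ℕ, 1 ≤ N → c * max ((N : ℝ) - (k : ℝ)) 0 ≤ EN N α)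
    {N m : ℕ} (hN : 1 ≤ N) (hm : 1 ≤ m) :
    c * (m : ℝ) ^ 2 * ((N : ℝ) - k * (m : ℝ) ^ 2) ≤ EN N α := by
  have hdef : EN N α = sInf {E | ∃ Ψ : Config N → ℂ, Admissible N Ψ ∧ normSq N Q0 Ψ = 1 ∧
      E = kinE N α Q0 Ψ} := by
    unfold EN neumannE
    rw [if_neg (by omega)]
  have hm1 : (1 : ℝ) ≤ m := by exact_mod_cast hm
  rcases Set.eq_empty_or_nonempty {E | ∃ Ψ : Config N → ℂ, Admissible N Ψ ∧
      normSq N Q0 Ψ = 1 ∧ E = kinE N α Q0 Ψ} with he | hne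
  · have h0 : EN N α = 0 := by rw [hdef, he, Real.sInf_empty]
    have h1 := h N hN
    rw [h0] at h1 ⊢
    have h2 : c * ((N : ℝ) - k) ≤ 0 :=
      le_trans (mul_le_mul_of_nonneg_left (le_max_left _ _) hc) h1
    have h3 : c * ((N : ℝ) - k * (m : ℝ) ^ 2) ≤ c * ((N : ℝ) - k) := by
      apply mul_le_mul_of_nonneg_left _ hc
      have : (k : ℝ) * 1 ≤ k * (m : ℝ) ^ 2 := by
        apply mul_le_mul_of_nonneg_left _ (by positivity)
        nlinarith
      linarith
    have h4 : 0 ≤ (m : ℝ) ^ 2 := by positivity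
    nlinarith
  · rw [hdef]
    apply le_csInf hne
    rintro E ⟨Ψ, hΨ, hn, rfl⟩
    have := ql_square hc h hm hΨ
    rwa [hn, mul_one] at this

/-- Lifting linear bounds to quadratic bounds: let `α ∈ [0,1]`, `k ≥ 1`,
`c ≥ 0` with `E^N_N(α) ≥ c max{N − k, 0}` for all `N ≥ 1`. Then for every `N ≥ 1`, with
`s := 1 + √(2k/N)`, `E^N_N(α) ≥ c (N²/(4k)) (2s² − s⁴)`. -/
theorem quadratic_lift (α : ℝ) (hα : α ∈ Set.Icc (0 : ℝ) 1) (k : ℕ) (hk : 1 ≤ k)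
    (c : ℝ) (hc : 0 ≤ c)
    (h : ∀ N : ℕ, 1 ≤ N → c * max ((N : ℝ) - (k : ℝ)) 0 ≤ EN N α) :
    ∀ N : ℕ, 1 ≤ N →
      c * ((N : ℝ) ^ 2 / (4 * (k : ℝ))) *
          (2 * (1 + Real.sqrt (2 * (k : ℝ) / (N : ℝ))) ^ 2 -
            (1 + Real.sqrt (2 * (k : ℝ) / (N : ℝ))) ^ 4) ≤
        EN N α := by
  intro N hN
  have hN0 : (0 : ℝ) < N := by exact_mod_cast hN
  have hk0 : (0 : ℝ) < k := by exact_mod_cast hk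
  set t : ℝ := Real.sqrt ((N : ℝ) / (2 * k)) with ht
  have ht0 : 0 < t := Real.sqrt_pos.2 (by positivity)
  have ht2 : t ^ 2 = (N : ℝ) / (2 * k) := Real.sq_sqrt (by positivity)
  have hNt : (N : ℝ) = 2 * k * t ^ 2 := by rw [ht2]; field_simp
  have hs : Real.sqrt (2 * (k : ℝ) / (N : ℝ)) = t⁻¹ := by
    rw [ht, ← Real.sqrt_inv, inv_div]
  have hm : 1 ≤ ⌈t⌉₊ := Nat.one_le_ceil_iff.2 ht0
  have hm1 : t ≤ (⌈t⌉₊ : ℝ) := Nat.le_ceil t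
  have hm2 : (⌈t⌉₊ : ℝ) ≤ t + 1 := (Nat.ceil_lt_add_one ht0.le).le
  refine le_trans ?_ (ql_EN_ge hk hc h hN hm)
  rw [hs]
  generalize (⌈t⌉₊ : ℝ) = m at hm1 hm2
  have e1 : c * ((N : ℝ) ^ 2 / (4 * (k : ℝ))) * (2 * (1 + t⁻¹) ^ 2 - (1 + t⁻¹) ^ 4) =
      (c * k) * (2 * t ^ 2 * (t + 1) ^ 2 - (t + 1) ^ 4) := by
    rw [hNt]
    field_simp
    ring
  have e2 : c * m ^ 2 * ((N : ℝ) - k * m ^ 2) = (c * k) * (2 * t ^ 2 * m ^ 2 - m ^ 4) := by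
    rw [hNt]; ring
  rw [e1, e2]
  apply mul_le_mul_of_nonneg_left _ (by positivity)
  have a1 : m ^ 2 ≤ (t + 1) ^ 2 := by gcongr; linarith
  have a2 : t ^ 2 ≤ m ^ 2 := by gcongr
  nlinarith [mul_nonneg (sub_nonneg.2 a1) (by linarith : 0 ≤ (t + 1) ^ 2 + m ^ 2 - 2 * t ^ 2)]
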